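/- arXiv:2506.02332 — 2 statements merged into one kernel-verified Lean document; each statement's English description precedes it below -/
import Mathlib

section
/- Let b ≥ 2, d ≥ 1, and let n ≥ 1 and i ∈ ℕ satisfy C(d,k)·n^k < b^i for every 1 ≤ k ≤ d (where C(d,k) is the binomial coefficient). Then the base-b digit representation of (b^i + n)^d consists of a leading 1 followed, for k = 1, 2, …, d in order, by i − |σ_b(C(d,k)·n^k)| zeros and then the digits of C(d,k)·n^k; equivalently, in little-endian digit lists, digits_b((b^i + n)^d) equals the concatenation over k = d, d−1, …, 1 of (digits_b(C(d,k)·n^k) ++ replicate(i − length(digits_b(C(d,k)·n^k)), 0)) followed by [1]. -/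
/-- A number written in base `b ^ i` has as base-`b` digits the concatenation of its zero-padded
base-`b ^ i` digits. -/
theorem digits_sum_mul_pow_add {b i m : ℕ} (hb : 1 < b) (hm : 0 < m) (d : ℕ) (a : ℕ → ℕ)
    (ha : ∀ j < d, a j < b ^ i) :
    Nat.digits b (∑ j ∈ Finset.range d, a j * (b ^ i) ^ j + (b ^ i) ^ d * m) =
      (List.ofFn (fun j : Fin d => Nat.digits b (a j) ++
        List.replicate (i - (Nat.digits b (a j)).length) 0)).flatten ++ Nat.digits b m := by
  induction d generalizing a with
  | zero => simp
  | succ d ih =>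
    have ih' := ih (fun j => a (j + 1)) fun j hj => ha (j + 1) (by omega)
    have hlen : (Nat.digits b (a 0)).length ≤ i :=
      (Nat.digits_length_le_iff hb _).2 (ha 0 d.succ_pos)
    have hpos : 0 < b ^ i := by positivity
    rw [List.ofFn_succ, List.flatten_cons, List.append_assoc]
    simp only [Fin.val_succ, Fin.val_zero]
    rw [← ih', Nat.digits_append_zeroes_append_digits hb (by positivity),
      Nat.add_sub_cancel' hlen, Finset.sum_range_succ']
    congr 1
    rw [mul_add, Finset.mul_sum]
    have hsum : ∑ j ∈ Finset.range d, a (j + 1) * (b ^ i) ^ (j + 1) =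
        ∑ j ∈ Finset.range d, b ^ i * (a (j + 1) * (b ^ i) ^ j) :=
      Finset.sum_congr rfl fun j _ => by ring
    rw [hsum]
    ring

/-- For `b ≥ 2`, `d ≥ 1`, `n ≥ 1` and `i` with
`C(d,k)·n^k < b^i` for every `1 ≤ k ≤ d`, the little-endian base-`b` digit list of
`(b^i + n)^d` is the concatenation, over `k = d, d−1, …, 1`, of
`digits_b(C(d,k)·n^k) ++ replicate (i − |digits_b(C(d,k)·n^k)|) 0`, followed by `[1]`
(i.e. big-endian: a leading 1 followed, for `k = 1, …, d` in order, by
`i − |σ_b(C(d,k)·n^k)|` zeros and the digits of `C(d,k)·n^k`). -/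
theorem stmt15 (b d n i : ℕ) (hb : 2 ≤ b) (hd : 1 ≤ d) (hn : 1 ≤ n)
    (h : ∀ k : ℕ, 1 ≤ k → k ≤ d → Nat.choose d k * n ^ k < b ^ i) :
    Nat.digits b ((b ^ i + n) ^ d) =
      (List.ofFn (fun j : Fin d =>
        Nat.digits b (Nat.choose d (d - (j : ℕ)) * n ^ (d - (j : ℕ))) ++
        List.replicate
          (i - (Nat.digits b (Nat.choose d (d - (j : ℕ)) * n ^ (d - (j : ℕ)))).length)
          0)).flatten ++ [1] := by
  have key := digits_sum_mul_pow_add (i := i) (m := 1) hb one_pos d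
    (fun j => Nat.choose d (d - j) * n ^ (d - j))
    fun j hj => h (d - j) (by omega) (Nat.sub_le d j)
  rw [Nat.digits_of_lt b 1 one_ne_zero hb] at key
  rw [← key, add_pow, Finset.sum_range_succ]
  congr 2
  · refine Finset.sum_congr rfl fun j hj => ?_
    rw [Nat.choose_symm (Finset.mem_range.1 hj).le]
    simp only [Nat.cast_id]
    ring
  · simp
end

section
/- Fix b ≥ 2 and ρ ∈ [0,1]. For l ≥ 1 define f(l) = −(1/l)·[(ρ + (1−ρ)b^{−l})·log_b(ρ + (1−ρ)b^{−l}) + (b^l − 1)·((1−ρ)b^{−l})·log_b((1−ρ)b^{−l})], with the convention 0·log 0 = 0. Then f(l) is non-increasing in l and lim_{l→∞} f(l) = 1 − ρ. -/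
/-- The `l`-th sliding block entropy (base `b`) of the limiting distribution assigning
probability `ρ + (1−ρ)b^{−l}` to the all-zeros word of length `l` and probability
`(1−ρ)b^{−l}` to each of the other `b^l − 1` words:
`f(l) = −(1/l)·[(ρ + (1−ρ)b^{−l})·log_b(ρ + (1−ρ)b^{−l})
        + (b^l − 1)·((1−ρ)b^{−l})·log_b((1−ρ)b^{−l})]`.
The convention `0 · log 0 = 0` holds automatically since `Real.logb b 0 = 0`. -/
noncomputable def zeroBlockEntropy (b : ℕ) (ρ : ℝ) (l : ℕ) : ℝ :=
  -(1 / (l : ℝ)) *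
    ((ρ + (1 - ρ) * ((b : ℝ) ^ l)⁻¹) * Real.logb b (ρ + (1 - ρ) * ((b : ℝ) ^ l)⁻¹) +
      ((b : ℝ) ^ l - 1) * ((1 - ρ) * ((b : ℝ) ^ l)⁻¹) *
        Real.logb b ((1 - ρ) * ((b : ℝ) ^ l)⁻¹))

open Real in
/-- With `c = 1 - ρ` and `u = c * exp (-t)`, the block entropy in nats at `t = l * log b`
is `c * t` plus this quantity. -/
noncomputable def entropyExcess (ρ t : ℝ) : ℝ :=
  negMulLog (ρ + (1 - ρ) * exp (-t)) - negMulLog ((1 - ρ) * exp (-t)) + negMulLog (1 - ρ)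

lemma zeroBlockEntropy_eq {b : ℕ} (hb : 2 ≤ b) {ρ : ℝ} (hρ : ρ ∈ Set.Icc (0 : ℝ) 1)
    {l : ℕ} (hl : 1 ≤ l) :
    zeroBlockEntropy b ρ l =
      1 - ρ + entropyExcess ρ (l * Real.log b) / (l * Real.log b) := by
  have hb0 : (0 : ℝ) < b := by positivity
  have hlog : 0 < Real.log b := Real.log_pos (by exact_mod_cast hb)
  have hl0 : (0 : ℝ) < l := by exact_mod_cast hl
  have hexp : Real.exp (-(l * Real.log b)) = ((b : ℝ) ^ l)⁻¹ := by
    rw [Real.exp_neg, Real.exp_nat_mul, Real.exp_log hb0]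
  have hpow : (0 : ℝ) < (b : ℝ) ^ l := by positivity
  unfold zeroBlockEntropy entropyExcess
  rw [hexp]
  rcases hρ.2.eq_or_lt with rfl | hlt
  · simp
  have hc : 0 < 1 - ρ := sub_pos.2 hlt
  have hlogu : Real.log ((1 - ρ) * ((b : ℝ) ^ l)⁻¹) = Real.log (1 - ρ) - l * Real.log b := by
    rw [Real.log_mul hc.ne' (by positivity), Real.log_inv, Real.log_pow]
    ring
  simp only [Real.negMulLog, Real.logb, hlogu]
  field_simp
  ring

lemma mul_log_add_sub_log_le {ρ u v : ℝ} (hρ : 0 ≤ ρ) (hv : 0 < v) (hvu : v ≤ u) :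
    v * (Real.log (ρ + v) - Real.log v) ≤ u * (Real.log (ρ + u) - Real.log u) := by
  have hu : 0 < u := hv.trans_le hvu
  rw [← Real.log_div (by positivity) hv.ne', ← Real.log_div (by positivity) hu.ne']
  have hbern : 1 + u / v * (ρ / u) ≤ (1 + ρ / u) ^ (u / v) :=
    one_add_mul_self_le_rpow_one_add (by linarith [div_nonneg hρ hu.le])
      ((one_le_div hv).2 hvu)
  have hlog := Real.log_le_log (by positivity) hbern
  rw [Real.log_rpow (by positivity),
    show 1 + u / v * (ρ / u) = (ρ + v) / v by field_simp; ring,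
    show 1 + ρ / u = (ρ + u) / u by field_simp; ring] at hlog
  calc v * Real.log ((ρ + v) / v) ≤ v * (u / v * Real.log ((ρ + u) / u)) := by gcongr
    _ = u * Real.log ((ρ + u) / u) := by field_simp

lemma hasDerivAt_entropyExcess {ρ : ℝ} (h0 : 0 ≤ ρ) (h1 : ρ < 1) (t : ℝ) :
    HasDerivAt (entropyExcess ρ) ((1 - ρ) * Real.exp (-t) *
      (Real.log (ρ + (1 - ρ) * Real.exp (-t)) - Real.log ((1 - ρ) * Real.exp (-t)))) t := by
  have hu : 0 < (1 - ρ) * Real.exp (-t) := mul_pos (sub_pos.2 h1) (Real.exp_pos _)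
  have hdu : HasDerivAt (fun t => (1 - ρ) * Real.exp (-t)) (-((1 - ρ) * Real.exp (-t))) t := by
    refine ((hasDerivAt_neg t).exp.const_mul (1 - ρ)).congr_deriv ?_
    ring
  refine HasDerivAt.congr_deriv ((((Real.hasDerivAt_negMulLog (by positivity)).comp t (hdu.const_add ρ)).sub
    ((Real.hasDerivAt_negMulLog hu.ne').comp t hdu)).add_const (Real.negMulLog (1 - ρ))) ?_
  ring

lemma concaveOn_entropyExcess {ρ : ℝ} (h0 : 0 ≤ ρ) (h1 : ρ < 1) :
    ConcaveOn ℝ Set.univ (entropyExcess ρ) := by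
  have hd := hasDerivAt_entropyExcess h0 h1
  refine Antitone.concaveOn_univ_of_deriv (fun t => (hd t).differentiableAt) fun s t hst => ?_
  rw [(hd s).deriv, (hd t).deriv]
  have hc : 0 < 1 - ρ := sub_pos.2 h1
  exact mul_log_add_sub_log_le h0 (by positivity) (by gcongr)

lemma entropyExcess_zero (ρ : ℝ) : entropyExcess ρ 0 = 0 := by simp [entropyExcess]

lemma entropyExcess_div_le {ρ : ℝ} (hρ : ρ ∈ Set.Icc (0 : ℝ) 1) {s t : ℝ} (hs : 0 < s)
    (hst : s ≤ t) : entropyExcess ρ t / t ≤ entropyExcess ρ s / s := by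
  have ht : 0 < t := hs.trans_le hst
  rcases hρ.2.eq_or_lt with rfl | hlt
  · simp [entropyExcess]
  have h := (concaveOn_entropyExcess hρ.1 hlt).2 (Set.mem_univ t) (Set.mem_univ 0)
    (div_nonneg hs.le ht.le) (sub_nonneg.2 ((div_le_one ht).2 hst)) (add_sub_cancel _ _)
  simp only [smul_eq_mul, entropyExcess_zero, mul_zero, add_zero, div_mul_cancel₀ s ht.ne'] at h
  rw [le_div_iff₀ hs]
  calc entropyExcess ρ t / t * s = s / t * entropyExcess ρ t := by ring
    _ ≤ entropyExcess ρ s := h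

open Filter Topology in
lemma tendsto_entropyExcess_div (ρ : ℝ) :
    Tendsto (fun t => entropyExcess ρ t / t) atTop (𝓝 0) := by
  have hu : Tendsto (fun t => (1 - ρ) * Real.exp (-t)) atTop (𝓝 0) := by
    simpa using Real.tendsto_exp_neg_atTop_nhds_zero.const_mul (1 - ρ)
  have hη := Real.continuous_negMulLog.tendsto
  exact ((((hη _).comp (hu.const_add ρ)).sub ((hη _).comp hu)).add_const
    (Real.negMulLog (1 - ρ))).div_atTop tendsto_id

/-- For `b ≥ 2` and `ρ ∈ [0,1]`, the quantity `f(l)` above is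
non-increasing in `l` (for `l ≥ 1`) and `lim_{l→∞} f(l) = 1 − ρ`. -/
theorem stmt16 (b : ℕ) (hb : 2 ≤ b) (ρ : ℝ) (hρ : ρ ∈ Set.Icc (0 : ℝ) 1) :
    AntitoneOn (zeroBlockEntropy b ρ) (Set.Ici 1) ∧
    Filter.Tendsto (zeroBlockEntropy b ρ) Filter.atTop (nhds (1 - ρ)) := by
  have hlog : 0 < Real.log b := Real.log_pos (by exact_mod_cast hb)
  constructor
  · intro m hm n hn hmn
    have hm0 : (0 : ℝ) < m := by exact_mod_cast hm
    rw [zeroBlockEntropy_eq hb hρ hm, zeroBlockEntropy_eq hb hρ hn]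
    gcongr 1 - ρ + ?_
    exact entropyExcess_div_le hρ (by positivity) (by gcongr)
  · have ht : Filter.Tendsto (fun l : ℕ => (l : ℝ) * Real.log b) Filter.atTop Filter.atTop :=
      tendsto_natCast_atTop_atTop.atTop_mul_const hlog
    have h := ((tendsto_entropyExcess_div ρ).comp ht).const_add (1 - ρ)
    rw [add_zero] at h
    refine h.congr' ?_
    filter_upwards [Filter.eventually_ge_atTop 1] with l hl
    exact (zeroBlockEntropy_eq hb hρ hl).symm
end
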